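/- arXiv:2502.15523 — 2 statements merged into one kernel-verified Lean document; each statement's English description precedes it below -/
import Mathlib

section
/- For every δ, ε ∈ (0,1) and every contract p ∈ ℝ^m_+, let p' = (1 − √ε) p + √ε r. Then, denoting by a^δ(p) a worst δ-best response to p (an action of A^δ(p) minimizing u^P(p,·)) and by a^{δ+ε}(p') a worst (δ+ε)-best response to p', it holds that u^P(p', a^{δ+ε}(p')) ≥ u^P(p, a^δ(p)) − 2√ε. -/
open scoped BigOperators

/-- An instance of a hidden-action principal-agent problem with action set `A`
and outcome set `O`. -/
structure PAInstance (A O : Type*) [Fintype A] [Fintype O] [Nonempty A] [Nonempty O] where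
  /-- `F a ω` is the probability that action `a` results in outcome `ω`. -/
  F : A → O → ℝ
  /-- principal's reward vector -/
  r : O → ℝ
  /-- agent's cost vector -/
  c : A → ℝ
  F_nonneg : ∀ a ω, 0 ≤ F a ω
  F_sum : ∀ a, ∑ ω, F a ω = 1
  r_mem : ∀ ω, r ω ∈ Set.Icc (0 : ℝ) 1
  c_mem : ∀ a, c a ∈ Set.Icc (0 : ℝ) 1
  /-- the opt-out action -/
  optOut : A
  optOut_cost : c optOut = 0
  optOut_reward : ∑ ω, F optOut ω * r ω = 0

namespace PAInstance

variable {A O : Type*} [Fintype A] [Fintype O] [Nonempty A] [Nonempty O]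

/-- A contract is a vector of nonnegative payments, one per outcome. -/
def IsContract (p : O → ℝ) : Prop := ∀ ω, 0 ≤ p ω

/-- Agent's expected utility `u^A(p, a) = F_a · p - c_a`. -/
def uA (I : PAInstance A O) (p : O → ℝ) (a : A) : ℝ := (∑ ω, I.F a ω * p ω) - I.c a

/-- Principal's expected utility `u^P(p, a) = F_a · (r - p)`. -/
def uP (I : PAInstance A O) (p : O → ℝ) (a : A) : ℝ := ∑ ω, I.F a ω * (I.r ω - p ω)

/-- The set of (exact) best responses `A(p)`. -/
def BR (I : PAInstance A O) (p : O → ℝ) : Set A := {a | ∀ a', I.uA p a' ≤ I.uA p a}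

/-- The set of `δ`-best responses
`A^δ(p) = {a : u^A(p,a) > max_{a'} u^A(p,a') - δ}`. -/
def dBR (I : PAInstance A O) (δ : ℝ) (p : O → ℝ) : Set A :=
  {a | ∀ a', I.uA p a' - δ < I.uA p a}

/-- `Ψ_δ(p) = min_{a ∈ A^δ(p)} u^P(p, a)`, the principal's robust utility in `p`. -/
noncomputable def Psi (I : PAInstance A O) (δ : ℝ) (p : O → ℝ) : ℝ :=
  sInf (I.uP p '' I.dBR δ p)

/-- `OPT(δ)`: the optimal δ-robust value. -/
noncomputable def OPTrob (I : PAInstance A O) (δ : ℝ) : ℝ :=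
  sSup {x | ∃ p, IsContract p ∧ x = I.Psi δ p}

/-- `OPT`: value of an optimal (non-robust) contract, where the agent breaks
ties in favor of the principal. -/
noncomputable def OPT (I : PAInstance A O) : ℝ :=
  sSup {x | ∃ p, IsContract p ∧ x = sSup (I.uP p '' I.BR p)}

/-- `SW = max_a (F_a · r - c_a)`, the maximum social welfare. -/
noncomputable def SW (I : PAInstance A O) : ℝ :=
  sSup (Set.range fun a => (∑ ω, I.F a ω * I.r ω) - I.c a)

end PAInstance

namespace PAInstance

lemma uA_mix {A O : Type*} [Fintype A] [Fintype O] [Nonempty A] [Nonempty O]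
    (I : PAInstance A O) (s : ℝ) (p : O → ℝ) (a : A) :
    I.uA (fun ω => (1 - s) * p ω + s * I.r ω) a = I.uA p a + s * I.uP p a := by
  have h : ∑ ω, I.F a ω * ((1 - s) * p ω + s * I.r ω)
      = ∑ ω, I.F a ω * p ω + s * ∑ ω, I.F a ω * (I.r ω - p ω) := by
    rw [Finset.mul_sum, ← Finset.sum_add_distrib]
    exact Finset.sum_congr rfl fun ω _ => by ring
  simp only [uA, uP, h]
  ring

lemma uP_mix {A O : Type*} [Fintype A] [Fintype O] [Nonempty A] [Nonempty O]
    (I : PAInstance A O) (s : ℝ) (p : O → ℝ) (a : A) :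
    I.uP (fun ω => (1 - s) * p ω + s * I.r ω) a = (1 - s) * I.uP p a := by
  simp only [uP, Finset.mul_sum]
  exact Finset.sum_congr rfl fun ω _ => by ring

lemma uP_le_one {A O : Type*} [Fintype A] [Fintype O] [Nonempty A] [Nonempty O]
    (I : PAInstance A O) {p : O → ℝ} (hp : IsContract p) (a : A) : I.uP p a ≤ 1 := by
  rw [uP, ← I.F_sum a]
  refine Finset.sum_le_sum fun ω _ => mul_le_of_le_one_right (I.F_nonneg a ω) ?_
  linarith [(I.r_mem ω).2, hp ω]

end PAInstance

/-- For `p' = (1-√ε)p + √ε r`, the worst (δ+ε)-best response to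
`p'` gives the principal at most `2√ε` less than the worst δ-best response
to `p`. -/
theorem epsilon_convert {A O : Type*} [Fintype A] [Fintype O] [Nonempty A] [Nonempty O]
    (I : PAInstance A O) (δ ε : ℝ) (hδ : δ ∈ Set.Ioo (0 : ℝ) 1)
    (hε : ε ∈ Set.Ioo (0 : ℝ) 1)
    (p : O → ℝ) (hp : PAInstance.IsContract p)
    (adel : A) (h1 : adel ∈ I.dBR δ p)
    (h2 : ∀ a ∈ I.dBR δ p, I.uP p adel ≤ I.uP p a)
    (adel' : A)
    (h3 : adel' ∈ I.dBR (δ + ε) (fun ω => (1 - Real.sqrt ε) * p ω + Real.sqrt ε * I.r ω))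
    (h4 : ∀ a ∈ I.dBR (δ + ε) (fun ω => (1 - Real.sqrt ε) * p ω + Real.sqrt ε * I.r ω),
      I.uP (fun ω => (1 - Real.sqrt ε) * p ω + Real.sqrt ε * I.r ω) adel'
        ≤ I.uP (fun ω => (1 - Real.sqrt ε) * p ω + Real.sqrt ε * I.r ω) a) :
    I.uP (fun ω => (1 - Real.sqrt ε) * p ω + Real.sqrt ε * I.r ω) adel'
      ≥ I.uP p adel - 2 * Real.sqrt ε := by
  obtain ⟨hε0, hε1⟩ := hε
  have hs0 : 0 < Real.sqrt ε := Real.sqrt_pos.2 hε0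
  have hs1 : Real.sqrt ε < 1 := by rw [Real.sqrt_lt' one_pos]; simpa using hε1
  have hsq : Real.sqrt ε * Real.sqrt ε = ε := Real.mul_self_sqrt hε0.le
  rw [I.uP_mix]
  have hle := I.uP_le_one hp adel
  obtain ⟨b, hb⟩ := Finite.exists_max (I.uA p)
  have hbV := h2 b fun a' => by linarith [hb a', hδ.1]
  have hkey : I.uP p adel - Real.sqrt ε ≤ I.uP p adel' := by
    by_cases ha : adel' ∈ I.dBR δ p
    · linarith [h2 adel' ha]
    · obtain ⟨a', ha'⟩ : ∃ a', I.uA p adel' ≤ I.uA p a' - δ := by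
        simpa [PAInstance.dBR] using ha
      have h := h3 b
      rw [I.uA_mix, I.uA_mix] at h
      refine le_of_mul_le_mul_left ?_ hs0
      nlinarith [hb a', mul_le_mul_of_nonneg_left hbV hs0.le]
  nlinarith [mul_le_mul_of_nonneg_left hkey (sub_pos.2 hs1).le,
    mul_le_mul_of_nonneg_left hle hs0.le]
end

section
/- For every δ ∈ (0,1), an optimal δ-robust contract exists: there is a contract p⋆ ∈ ℝ^m_+ such that Ψ_δ(p⋆) ≥ Ψ_δ(p) for every contract p ∈ ℝ^m_+, i.e., the supremum defining OPT(δ) is attained. -/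
open scoped BigOperators

namespace PAInstance

variable {A O : Type*} [Fintype A] [Fintype O] [Nonempty A] [Nonempty O]

lemma continuous_uA (I : PAInstance A O) (a : A) : Continuous fun p => I.uA p a := by
  unfold uA
  fun_prop

lemma continuous_uP (I : PAInstance A O) (a : A) : Continuous fun p => I.uP p a := by
  unfold uP
  fun_prop

lemma BR_nonempty (I : PAInstance A O) (p : O → ℝ) : (I.BR p).Nonempty :=
  Finite.exists_max (I.uA p)

lemma BR_subset_dBR (I : PAInstance A O) {δ : ℝ} (hδ : 0 < δ) (p : O → ℝ) :
    I.BR p ⊆ I.dBR δ p := fun a ha a' => by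
  linarith [ha a']

lemma dBR_nonempty (I : PAInstance A O) {δ : ℝ} (hδ : 0 < δ) (p : O → ℝ) :
    (I.dBR δ p).Nonempty :=
  (I.BR_nonempty p).mono (I.BR_subset_dBR hδ p)

lemma Psi_le_uP (I : PAInstance A O) {δ : ℝ} {p : O → ℝ} {a : A} (ha : a ∈ I.dBR δ p) :
    I.Psi δ p ≤ I.uP p a :=
  csInf_le (Set.toFinite _).bddBelow (Set.mem_image_of_mem _ ha)

lemma exists_mem_dBR_uP_eq_Psi (I : PAInstance A O) {δ : ℝ} (hδ : 0 < δ) (p : O → ℝ) :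
    ∃ a ∈ I.dBR δ p, I.uP p a = I.Psi δ p :=
  ((I.dBR_nonempty hδ p).image (I.uP p)).csInf_mem (Set.toFinite _)

/-- Since `δ`-best responses are defined by strict inequalities, they persist under small
perturbations of the contract. -/
lemma eventually_mem_dBR (I : PAInstance A O) {δ : ℝ} {p : O → ℝ} {a : A}
    (ha : a ∈ I.dBR δ p) : ∀ᶠ q in nhds p, a ∈ I.dBR δ q := by
  refine Filter.eventually_all.2 fun a' => ?_
  exact ((I.continuous_uA a').sub continuous_const).continuousAt.eventually_lt
    (I.continuous_uA a).continuousAt (ha a')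

lemma upperSemicontinuous_Psi (I : PAInstance A O) {δ : ℝ} (hδ : 0 < δ) :
    UpperSemicontinuous (I.Psi δ) := by
  intro p y hy
  obtain ⟨a, ha, hap⟩ := I.exists_mem_dBR_uP_eq_Psi hδ p
  rw [← hap] at hy
  filter_upwards [I.eventually_mem_dBR ha,
    (I.continuous_uP a).continuousAt.eventually_lt continuousAt_const hy] with q hq hqy
  exact (I.Psi_le_uP hq).trans_lt hqy

/-- Payments on outcomes of probability zero do not affect the principal's robust utility. -/
lemma Psi_congr (I : PAInstance A O) (δ : ℝ) {p q : O → ℝ}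
    (h : ∀ a ω, I.F a ω * p ω = I.F a ω * q ω) : I.Psi δ p = I.Psi δ q := by
  have hA : I.uA p = I.uA q := by
    funext a
    simp only [uA, h]
  have hP : I.uP p = I.uP q := by
    funext a
    simp only [uP, mul_sub, h]
  simp only [Psi, dBR, hA, hP]

lemma expected_reward_le_one (I : PAInstance A O) (a : A) : ∑ ω, I.F a ω * I.r ω ≤ 1 := by
  rw [← I.F_sum a]
  exact Finset.sum_le_sum fun ω _ => mul_le_of_le_one_right (I.F_nonneg a ω) (I.r_mem ω).2

lemma Psi_zero_nonneg (I : PAInstance A O) {δ : ℝ} (hδ : 0 < δ) : 0 ≤ I.Psi δ 0 := by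
  obtain ⟨a, -, ha⟩ := I.exists_mem_dBR_uP_eq_Psi hδ 0
  rw [← ha]
  refine Finset.sum_nonneg fun ω _ => mul_nonneg (I.F_nonneg a ω) ?_
  simpa using (I.r_mem ω).1

/-- If the principal's robust utility is nonnegative, all expected payments are at most `2`. -/
lemma expected_payment_le_two (I : PAInstance A O) {δ : ℝ} (hδ : 0 < δ) {p : O → ℝ}
    (hp : 0 ≤ I.Psi δ p) (a : A) : ∑ ω, I.F a ω * p ω ≤ 2 := by
  obtain ⟨b, hb⟩ := I.BR_nonempty p
  have h₁ := hp.trans (I.Psi_le_uP (I.BR_subset_dBR hδ p hb))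
  have h₂ := hb a
  simp only [uP, mul_sub, Finset.sum_sub_distrib] at h₁
  simp only [uA] at h₂
  linarith [I.expected_reward_le_one b, (I.c_mem a).2, (I.c_mem b).1]

/-- A bound on the payments that a contract with nonnegative robust utility needs; it is zero on
outcomes that no action can produce. -/
noncomputable def paymentBound (I : PAInstance A O) (ω : O) : ℝ :=
  2 * Fintype.card A / ∑ a, I.F a ω

lemma paymentBound_nonneg (I : PAInstance A O) (ω : O) : 0 ≤ I.paymentBound ω :=
  div_nonneg (by positivity) (Finset.sum_nonneg fun a _ => I.F_nonneg a ω)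

lemma le_paymentBound (I : PAInstance A O) {δ : ℝ} (hδ : 0 < δ) {p : O → ℝ}
    (hpc : IsContract p) (hp : 0 ≤ I.Psi δ p) {a : A} {ω : O} (ha : I.F a ω ≠ 0) :
    p ω ≤ I.paymentBound ω := by
  have hpos : 0 < ∑ a, I.F a ω :=
    Finset.sum_pos' (fun a _ => I.F_nonneg a ω)
      ⟨a, Finset.mem_univ a, (I.F_nonneg a ω).lt_of_ne' ha⟩
  rw [paymentBound, le_div_iff₀ hpos, mul_comm, Finset.sum_mul]
  have hle : ∀ b ∈ Finset.univ, I.F b ω * p ω ≤ 2 := fun b _ =>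
    (Finset.single_le_sum (f := fun ω => I.F b ω * p ω)
      (fun ω _ => mul_nonneg (I.F_nonneg b ω) (hpc ω)) (Finset.mem_univ ω)).trans
      (I.expected_payment_le_two hδ hp b)
  have := Finset.sum_le_card_nsmul _ _ _ hle
  rw [nsmul_eq_mul, Finset.card_univ] at this
  linarith

end PAInstance

/-- An optimal δ-robust contract always exists. -/
theorem exists_optimal_robust_contract {A O : Type*} [Fintype A] [Fintype O]
    [Nonempty A] [Nonempty O]
    (I : PAInstance A O) (δ : ℝ) (hδ : δ ∈ Set.Ioo (0 : ℝ) 1) :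
    ∃ pstar : O → ℝ, PAInstance.IsContract pstar ∧
      ∀ p : O → ℝ, PAInstance.IsContract p → I.Psi δ p ≤ I.Psi δ pstar := by
  have hB : (0 : O → ℝ) ≤ I.paymentBound := I.paymentBound_nonneg
  have h0 : (0 : O → ℝ) ∈ Set.Icc 0 I.paymentBound := Set.left_mem_Icc.2 hB
  obtain ⟨q, hq, hmax⟩ := ((I.upperSemicontinuous_Psi hδ.1).upperSemicontinuousOn
    (Set.Icc 0 I.paymentBound)).exists_isMaxOn ⟨0, h0⟩ isCompact_Icc
  refine ⟨q, hq.1, fun p hpc => ?_⟩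
  rcases lt_or_ge (I.Psi δ p) 0 with hp | hp
  · exact hp.le.trans ((I.Psi_zero_nonneg hδ.1).trans (hmax h0))
  · have hcongr : I.Psi δ p = I.Psi δ (p ⊓ I.paymentBound) := by
      refine I.Psi_congr δ fun a ω => ?_
      by_cases ha : I.F a ω = 0
      · simp [ha]
      · rw [Pi.inf_apply, inf_eq_left.2 (I.le_paymentBound hδ.1 hpc hp ha)]
    rw [hcongr]
    exact hmax ⟨le_inf hpc hB, inf_le_right⟩
end
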